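/- Let V be a finite-dimensional vector space over an ordered field (or ℝ) with a symmetric bilinear form B, and suppose V = U ⊕ W ⊕ Z with B(U,U) = 0, B(U,W) = 0, B(W,Z) = 0, B(Z,Z) = 0, and B nondegenerate. Then the signature of B equals the signature of the restriction of B to W. -/

import Mathlib

open Classical in
/-- Signature of a real symmetric matrix. -/
noncomputable def matSig {ι : Type*} [Fintype ι] [DecidableEq ι]
    (M : Matrix ι ι ℝ) : ℤ :=
  if h : M.IsHermitian then
    ((Finset.univ.filter fun i => 0 < h.eigenvalues i).card : ℤ) -
      ((Finset.univ.filter fun i => h.eigenvalues i < 0).card : ℤ)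
  else 0

/-- Signature of a bilinear form on a finite-dimensional real vector space,
computed as the signature of its Gram matrix in a basis. -/
noncomputable def formSig (V : Type*) [AddCommGroup V] [Module ℝ V]
    [FiniteDimensional ℝ V] (B : LinearMap.BilinForm ℝ V) : ℤ :=
  matSig ((BilinForm.toMatrix (Module.finBasis ℝ V)) B)

open QuadraticMap in
/-- Eigenvectors of the Gram matrix of a symmetric form assemble to a diagonalizing basis. -/
theorem equivalent_weightedSumSquares_eigenvalues {V ι : Type*} [AddCommGroup V] [Module ℝ V]
    [Fintype ι] [DecidableEq ι] (b : Module.Basis ι ℝ V) (B : LinearMap.BilinForm ℝ V)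
    (h : (LinearMap.BilinForm.toMatrix b B).IsHermitian) :
    B.toQuadraticMap.Equivalent (weightedSumSquares ℝ h.eigenvalues) := by
  set v : Module.Basis ι ℝ V :=
    (h.eigenvectorBasis.toBasis.map (WithLp.linearEquiv 2 ℝ (ι → ℝ))).map b.equivFun.symm with hv
  have hrepr (i : ι) : ⇑(b.repr (v i)) = ⇑(h.eigenvectorBasis i) := by
    simp only [hv, Module.Basis.map_apply, OrthonormalBasis.coe_toBasis,
      WithLp.linearEquiv_apply, ← Module.Basis.equivFun_apply, LinearEquiv.apply_symm_apply]
    rfl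
  have hB (i j : ι) : B (v i) (v j) = if i = j then h.eigenvalues j else 0 := by
    have key := orthonormal_iff_ite.mp h.eigenvectorBasis.orthonormal j i
    rw [EuclideanSpace.inner_eq_star_dotProduct, star_trivial] at key
    rw [LinearMap.BilinForm.apply_eq_dotProduct_toMatrix_mulVec b, hrepr, hrepr,
      h.mulVec_eigenvectorBasis, dotProduct_smul, key]
    simp [eq_comm]
  refine ⟨(B.toQuadraticMap.isometryEquivBasisRepr v).trans ⟨LinearEquiv.refl ℝ _, fun m => ?_⟩⟩
  simp [basisRepr_apply, weightedSumSquares_apply, hB]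
  exact Finset.sum_congr rfl fun i _ => by ring

theorem matSig_toMatrix {V ι : Type*} [AddCommGroup V] [Module ℝ V]
    [Fintype ι] [DecidableEq ι] (b : Module.Basis ι ℝ V) (B : LinearMap.BilinForm ℝ V)
    (hsymm : ∀ x y, B x y = B y x) :
    matSig (LinearMap.BilinForm.toMatrix b B) =
      (sigPos B.toQuadraticMap : ℤ) - sigNeg B.toQuadraticMap := by
  have h : (LinearMap.BilinForm.toMatrix b B).IsHermitian := by
    ext i j
    simp [LinearMap.BilinForm.toMatrix_apply, hsymm]
  have e := equivalent_weightedSumSquares_eigenvalues b B h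
  rw [matSig, dif_pos h, QuadraticForm.sigPos_of_equiv_weightedSumSquares e,
    QuadraticForm.sigNeg_of_equiv_weightedSumSquares e]
  simp [Set.ncard_eq_toFinset_card']

theorem sigPos_add_sigNeg_of_nondegenerate {V : Type*} [AddCommGroup V] [Module ℝ V]
    [FiniteDimensional ℝ V] (B : LinearMap.BilinForm ℝ V) (hsymm : ∀ x y, B x y = B y x)
    (hnd : ∀ x, (∀ y, B x y = 0) → x = 0) :
    sigPos B.toQuadraticMap + sigNeg B.toQuadraticMap = Module.finrank ℝ V := by
  have hrad : B.toQuadraticMap.radical = ⊥ := by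
    rw [QuadraticMap.radical_eq_ker_associated,
      QuadraticMap.associated_left_inverse ℝ hsymm]
    exact LinearMap.separatingLeft_iff_ker_eq_bot.mp hnd
  have := QuadraticForm.sigPos_add_sigNeg_add_radical (Q := B.toQuadraticMap)
  rwa [hrad, finrank_bot, add_zero] at this

/-- Adding an isotropic subspace orthogonal to `W` to a negative definite subspace of `W`
bounds the positive index. -/
theorem sigPos_add_sigNeg_restrict_add_finrank_le {V : Type*} [AddCommGroup V] [Module ℝ V]
    [FiniteDimensional ℝ V] (B : LinearMap.BilinForm ℝ V) (hsymm : ∀ x y, B x y = B y x)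
    {U W : Submodule ℝ V} (hd : Disjoint U W)
    (hUU : ∀ u ∈ U, ∀ u' ∈ U, B u u' = 0) (hUW : ∀ u ∈ U, ∀ w ∈ W, B u w = 0) :
    sigPos B.toQuadraticMap + sigNeg (B.restrict W).toQuadraticMap + Module.finrank ℝ U ≤
      Module.finrank ℝ V := by
  obtain ⟨N, hN, hneg⟩ := exists_finrank_eq_sigNeg_and_negDef
    (B.restrict W).toQuadraticMap
  have hle : N.map W.subtype ≤ W := Submodule.map_subtype_le W N
  have hdim := Submodule.finrank_sup_add_finrank_inf_eq (N.map W.subtype) U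
  rw [(hd.symm.mono_left hle).eq_bot, finrank_bot, add_zero,
    Submodule.finrank_map_subtype_eq, hN] at hdim
  have := QuadraticForm.sigPos_add_finrank_le_of_nonpos (Q := B.toQuadraticMap)
    (V := N.map W.subtype ⊔ U) (fun x hx => by
      obtain ⟨_, ⟨n, hn, rfl⟩, u, hu, rfl⟩ := Submodule.mem_sup.mp hx
      have h1 : B u n = 0 := hUW u hu n n.2
      have h2 : B n n ≤ 0 := by
        by_cases h0 : n = 0
        · simp [h0]
        · have := hneg ⟨n, hn⟩ (by simpa using h0)
          simpa using this.le
      simp [hUU u hu u hu, h1, hsymm n u, h2])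
  omega

/-- If `V = U ⊕ W ⊕ Z` with `B(U,U) = 0`, `B(U,W) = 0`, `B(W,Z) = 0`, `B(Z,Z) = 0` and
`B` a nondegenerate symmetric bilinear form, then the signature of `B` equals the signature
of the restriction of `B` to `W`. -/
theorem signature_eq_of_orthogonal_decomposition
    (V : Type*) [AddCommGroup V] [Module ℝ V] [FiniteDimensional ℝ V]
    (B : LinearMap.BilinForm ℝ V)
    (hsymm : ∀ x y, B x y = B y x) (hnd : B.Nondegenerate)
    (U W Z : Submodule ℝ V)
    (hspan : U ⊔ W ⊔ Z = ⊤) (hUWZ : U ⊓ (W ⊔ Z) = ⊥) (hWZ : W ⊓ Z = ⊥)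
    (hUU : ∀ u ∈ U, ∀ u' ∈ U, B u u' = 0)
    (hUW : ∀ u ∈ U, ∀ w ∈ W, B u w = 0)
    (hWZortho : ∀ w ∈ W, ∀ z ∈ Z, B w z = 0)
    (hZZ : ∀ z ∈ Z, ∀ z' ∈ Z, B z z' = 0) :
    formSig V B = formSig W (B.restrict W) := by
  have hnd' : ∀ x, (∀ y, B x y = 0) → x = 0 := hnd.1
  have hVmem (x : V) : ∃ u ∈ U, ∃ w ∈ W, ∃ z ∈ Z, x = u + w + z := by
    have hx : x ∈ U ⊔ W ⊔ Z := hspan ▸ Submodule.mem_top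
    obtain ⟨_, ha, z, hz, rfl⟩ := Submodule.mem_sup.mp hx
    obtain ⟨u, hu, w, hw, rfl⟩ := Submodule.mem_sup.mp ha
    exact ⟨u, hu, w, hw, z, hz, rfl⟩
  have hWnd (w : W) (h : ∀ w' : W, B.restrict W w w' = 0) : w = 0 := by
    refine Subtype.ext (hnd' w fun y => ?_)
    obtain ⟨u, hu, w', hw', z, hz, rfl⟩ := hVmem y
    have h1 : B w w' = 0 := h ⟨w', hw'⟩
    simp [h1, hsymm w u, hUW u hu w w.2, hWZortho w w.2 z hz]
  have hZU : Module.finrank ℝ Z ≤ Module.finrank ℝ U := by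
    rw [← Subspace.dual_finrank_eq (K := ℝ) (V := U)]
    refine LinearMap.finrank_le_finrank_of_injective (f := B.domRestrict₁₂ Z U) ?_
    refine (injective_iff_map_eq_zero _).mpr fun z hz0 => Subtype.ext (hnd' z fun y => ?_)
    obtain ⟨u, hu, w, hw, z', hz', rfl⟩ := hVmem y
    have h1 : B z u = 0 := LinearMap.congr_fun hz0 ⟨u, hu⟩
    simp [h1, hsymm z w, hWZortho w hw z z.2, hZZ z z.2 z' hz']
  have hUWd : Disjoint U W := (disjoint_iff.mpr hUWZ).mono_right le_sup_left
  have hdim : Module.finrank ℝ V =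
      Module.finrank ℝ U + Module.finrank ℝ W + Module.finrank ℝ Z := by
    have h1 := Submodule.finrank_sup_add_finrank_inf_eq U (W ⊔ Z)
    have h2 := Submodule.finrank_sup_add_finrank_inf_eq W Z
    rw [← sup_assoc, hspan, hUWZ, finrank_top, finrank_bot] at h1
    rw [hWZ, finrank_bot] at h2
    omega
  have hsymmW (x y : W) : B.restrict W x y = B.restrict W y x := hsymm x y
  have hV := sigPos_add_sigNeg_of_nondegenerate B hsymm hnd'
  have hW := sigPos_add_sigNeg_of_nondegenerate (B.restrict W) hsymmW hWnd
  have hpos := sigPos_add_sigNeg_restrict_add_finrank_le B hsymm hUWd hUU hUW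
  have hneg := sigPos_add_sigNeg_restrict_add_finrank_le (-B) (by simp [hsymm]) hUWd
    (by simpa using hUU) (by simpa using hUW)
  have e1 : (-B).toQuadraticMap = -B.toQuadraticMap := by ext; simp
  have e2 : ((-B).restrict W).toQuadraticMap = -(B.restrict W).toQuadraticMap := by ext; simp
  rw [e1, e2, sigPos_neg, sigNeg_neg] at hneg
  have hVsig : formSig V B = _ := matSig_toMatrix _ B hsymm
  have hWsig : formSig W (B.restrict W) = _ := matSig_toMatrix _ _ hsymmW
  rw [hVsig, hWsig]
  omega
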